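/- arXiv:2001.08628 — 2 statements merged into one kernel-verified Lean document; each statement's English description precedes it below -/
import Mathlib

section
/- There is a constant C > 0 such that for every integer n ≥ 4, |ldim(Q(n; 1, ⌊n/2⌋)) − n/log n| ≤ C · n · log log n / (log n)². In particular, ldim(Q(n; 1, ⌊n/2⌋)) is asymptotic to n/log n as n → ∞. -/
open scoped Classical

namespace PaperLD

/-- A partial linear extension of a poset `α`: a duplicate-free list whose
listing order extends the partial order on the elements it contains. -/
structure PLE (α : Type*) [PartialOrder α] where
  toList : List α
  nodup : toList.Nodup
  le_imp : ∀ i j : Fin toList.length, toList.get i ≤ toList.get j → i ≤ j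

/-- `x` occurs (weakly) before `y` in the partial linear extension `L`
(in particular both `x` and `y` belong to the ground set of `L`). -/
def PLE.Before {α : Type*} [PartialOrder α] (L : PLE α) (x y : α) : Prop :=
  ∃ i j : Fin L.toList.length, i ≤ j ∧ L.toList.get i = x ∧ L.toList.get j = y

/-- A family of partial linear extensions is a local realiser if, for every
ordered pair `(x, y)` with `x ≱ y`, some member lists `x` before `y`. -/
def IsLocalRealiser {α : Type*} [PartialOrder α] {ι : Type*} (F : ι → PLE α) : Prop :=
  ∀ x y : α, ¬ y ≤ x → ∃ i, (F i).Before x y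

/-- The multiplicity of `x` in a finite family of partial linear extensions:
the number of members whose ground set contains `x`. -/
noncomputable def mult {α : Type*} [PartialOrder α] {N : ℕ} (F : Fin N → PLE α) (x : α) : ℕ :=
  (Finset.univ.filter fun i => x ∈ (F i).toList).card

/-- The local dimension of a finite poset: the least `d` such that there is a
local realiser in which every element has multiplicity at most `d`. -/
noncomputable def ldim (α : Type*) [PartialOrder α] [Fintype α] : ℕ :=
  sInf {d | ∃ (N : ℕ) (F : Fin N → PLE α), IsLocalRealiser F ∧ ∀ x : α, mult F x ≤ d}

/-- The order dimension of a finite poset: the least `d` such that some family of `d`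
linear extensions (partial linear extensions containing every element) is a realiser. -/
noncomputable def odim (α : Type*) [PartialOrder α] [Fintype α] : ℕ :=
  sInf {d | ∃ F : Fin d → PLE α, (∀ i, ∀ x : α, x ∈ (F i).toList) ∧ IsLocalRealiser F}

/-- `BoolLayers n ℓ k` is the suborder of the Boolean lattice `Q(n)` induced by the
`ℓ`-th and `k`-th layers: all subsets of an `n`-set of cardinality `ℓ` or `k`,
ordered by inclusion. -/
abbrev BoolLayers (n ℓ k : ℕ) := {s : Finset (Fin n) // s.card = ℓ ∨ s.card = k}

end PaperLD

open PaperLD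

namespace PaperLD

section PartialLinearExtensions

variable {α : Type*} [PartialOrder α]

/-- A list in which no element lies above a later one is a partial linear extension. -/
def PLE.ofPairwise (l : List α) (h : l.Pairwise fun a b => ¬ b ≤ a) : PLE α where
  toList := l
  nodup := h.imp fun hab e => hab e.ge
  le_imp := fun i j hij => by
    by_contra! hlt
    exact List.pairwise_iff_get.1 h j i hlt hij

lemma PLE.before_of_sublist {L : PLE α} {x y : α} (h : [x, y].Sublist L.toList) :
    L.Before x y := by
  obtain ⟨f, hf⟩ := List.sublist_iff_exists_fin_orderEmbedding_get_eq.1 h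
  refine ⟨f ⟨0, by simp⟩, f ⟨1, by simp⟩, ?_, ?_, ?_⟩
  · exact f.monotone (by simp)
  · simpa using (hf ⟨0, by simp⟩).symm
  · simpa using (hf ⟨1, by simp⟩).symm

lemma PLE.before_iff {L : PLE α} {x y : α} :
    L.Before x y ↔ x ∈ L.toList ∧ y ∈ L.toList ∧ L.toList.idxOf x ≤ L.toList.idxOf y := by
  constructor
  · rintro ⟨i, j, hij, rfl, rfl⟩
    refine ⟨List.get_mem _ _, List.get_mem _ _, ?_⟩
    simpa [L.nodup.idxOf_getElem] using hij
  · rintro ⟨hx, hy, h⟩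
    exact ⟨⟨_, List.idxOf_lt_length_iff.2 hx⟩, ⟨_, List.idxOf_lt_length_iff.2 hy⟩, h,
      by simp, by simp⟩

lemma PLE.Before.trans {L : PLE α} {x y z : α} (h : L.Before x y) (h' : L.Before y z) :
    L.Before x z := by
  rw [PLE.before_iff] at *
  exact ⟨h.1, h'.2.1, h.2.2.trans h'.2.2⟩

lemma PLE.Before.antisymm {L : PLE α} {x y : α} (h : L.Before x y) (h' : L.Before y x) :
    x = y := by
  rw [PLE.before_iff] at *
  exact (List.idxOf_inj h.1).1 (le_antisymm h.2.2 h'.2.2)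

lemma PLE.Before.not_le {L : PLE α} {x y : α} (h : L.Before x y) (hne : x ≠ y) : ¬ y ≤ x := by
  intro hyx
  obtain ⟨i, j, hij, rfl, rfl⟩ := h
  exact hne (congrArg _ (le_antisymm hij (L.le_imp _ _ hyx)))

/-- Among finitely many elements some of which lie after `x`, there is a first one. -/
lemma PLE.exists_first_after {ι : Type*} [Fintype ι] {L : PLE α} {x : α} (f : ι → α)
    (h : ∃ i, L.Before x (f i)) :
    ∃ i, L.Before x (f i) ∧ ∀ i', L.Before x (f i') → L.Before (f i) (f i') := by
  obtain ⟨i, hi⟩ := h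
  obtain ⟨i₀, h₀, hmin⟩ := Finset.exists_min_image
    (Finset.univ.filter fun i' => L.Before x (f i'))
    (fun i' => L.toList.idxOf (f i')) ⟨i, by simpa using hi⟩
  simp only [Finset.mem_filter, Finset.mem_univ, true_and] at h₀ hmin
  exact ⟨i₀, h₀, fun i' h' =>
    PLE.before_iff.2 ⟨(PLE.before_iff.1 h₀).2.1, (PLE.before_iff.1 h').2.1, hmin i' h'⟩⟩

lemma pair_sublist_or {β : Type*} {l : List β} {x y : β} (hx : x ∈ l) (hy : y ∈ l) (hne : x ≠ y) :
    [x, y].Sublist l ∨ [x, y].Sublist l.reverse := by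
  obtain ⟨s, t, rfl⟩ := List.append_of_mem hx
  rcases List.mem_append.1 hy with h | h
  · right
    have h1 : [y].Sublist s := List.singleton_sublist.2 h
    have h2 : [x].Sublist (x :: t) := List.singleton_sublist.2 (by simp)
    simpa using (h1.append h2).reverse
  · left
    have h' : y ∈ t := by
      rcases List.mem_cons.1 h with h | h
      · exact absurd h.symm hne
      · exact h
    exact ((List.singleton_sublist.2 h').cons_cons x).trans (List.sublist_append_right s _)

lemma pair_sublist_append {β : Type*} {l m : List β} {x y : β} (hx : x ∈ l) (hy : y ∈ m) :
    [x, y].Sublist (l ++ m) :=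
  (List.singleton_sublist.2 hx).append (List.singleton_sublist.2 hy)

/-- A local realiser indexed by an arbitrary finite type bounds the local dimension. -/
lemma exists_fin_realiser {ι : Type*} [Fintype ι] (F : ι → PLE α) (hF : IsLocalRealiser F)
    (d : ℕ) (hd : ∀ x, (Finset.univ.filter fun i => x ∈ (F i).toList).card ≤ d) :
    ∃ (N : ℕ) (G : Fin N → PLE α), IsLocalRealiser G ∧ ∀ x : α, mult G x ≤ d := by
  let e := Fintype.equivFin ι
  refine ⟨Fintype.card ι, fun i => F (e.symm i), ?_, ?_⟩
  · intro x y hxy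
    obtain ⟨i, hi⟩ := hF x y hxy
    exact ⟨e i, by simpa using hi⟩
  · intro x
    refine le_trans (Finset.card_le_card_of_injOn e.symm ?_ e.symm.injective.injOn) (hd x)
    intro i hi
    simpa using hi

end PartialLinearExtensions

section TwoLayers

variable {n k : ℕ}

lemma BoolLayers.not_le_of_card {x y : BoolLayers n 1 k} (hk : 2 ≤ k) (hx : x.1.card = 1)
    (hy : y.1.card = k) : ¬ y ≤ x := fun h => by
  have := Finset.card_le_card (show y.1 ⊆ x.1 from h)
  omega

lemma BoolLayers.eq_of_le_of_card {x y : BoolLayers n 1 k} (h : x ≤ y)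
    (hc : x.1.card = y.1.card) : x = y :=
  Subtype.ext (Finset.eq_of_subset_of_card_le h hc.ge)

/-- The members of a layer of cardinality `c`, as a list. -/
noncomputable def layerList (n k c : ℕ) : List (BoolLayers n 1 k) :=
  (Finset.univ.filter fun x : BoolLayers n 1 k => x.1.card = c).toList

lemma mem_layerList {c : ℕ} {x : BoolLayers n 1 k} : x ∈ layerList n k c ↔ x.1.card = c := by
  simp [layerList]

lemma pairwise_of_card {c : ℕ} {l : List (BoolLayers n 1 k)} (hl : l.Nodup)
    (hc : ∀ x ∈ l, x.1.card = c) : l.Pairwise fun a b => ¬ b ≤ a :=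
  List.Pairwise.imp_of_mem (fun {a b} ha hb hab h =>
    hab (BoolLayers.eq_of_le_of_card h ((hc b hb).trans (hc a ha).symm)).symm) hl

/-- The linear extension listing the first layer and then the `k`-th layer, each of them
possibly reversed. -/
noncomputable def fullExt (n k : ℕ) (hk : 2 ≤ k) (r : Bool) : PLE (BoolLayers n 1 k) :=
  PLE.ofPairwise
    (if r then (layerList n k 1).reverse ++ (layerList n k k).reverse
      else layerList n k 1 ++ layerList n k k) <| by
    have hn : ∀ c, (layerList n k c).Nodup := fun c => Finset.nodup_toList _
    split_ifs
    · refine List.pairwise_append.2 ⟨pairwise_of_card (c := 1) ?_ ?_,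
        pairwise_of_card (c := k) ?_ ?_, ?_⟩
      · exact List.nodup_reverse.2 (hn 1)
      · simp [mem_layerList]
      · exact List.nodup_reverse.2 (hn k)
      · simp [mem_layerList]
      · intro a ha b hb
        exact BoolLayers.not_le_of_card hk (by simpa [mem_layerList] using ha)
          (by simpa [mem_layerList] using hb)
    · refine List.pairwise_append.2 ⟨pairwise_of_card (c := 1) (hn 1) ?_,
        pairwise_of_card (c := k) (hn k) ?_, ?_⟩
      · simp [mem_layerList]
      · simp [mem_layerList]
      · intro a ha b hb
        exact BoolLayers.not_le_of_card hk (mem_layerList.1 ha) (mem_layerList.1 hb)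

lemma exists_fullExt_before (hk : 2 ≤ k) {x y : BoolLayers n 1 k} (hne : x ≠ y)
    (hxy : x.1.card = 1 ∨ y.1.card = k) : ∃ r, (fullExt n k hk r).Before x y := by
  have same : ∀ c, (c = 1 ∨ c = k) → x.1.card = c → y.1.card = c →
      ∃ r, (fullExt n k hk r).Before x y := by
    intro c hc hx hy
    rcases pair_sublist_or (mem_layerList.2 hx) (mem_layerList.2 hy) hne with h | h
    · refine ⟨false, PLE.before_of_sublist (h.trans ?_)⟩
      rcases hc with rfl | rfl
      · simp [fullExt, PLE.ofPairwise]
      · simp [fullExt, PLE.ofPairwise]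
    · refine ⟨true, PLE.before_of_sublist (h.trans ?_)⟩
      rcases hc with rfl | rfl
      · simp [fullExt, PLE.ofPairwise]
      · simp [fullExt, PLE.ofPairwise]
  rcases x.2 with hx | hx
  · rcases y.2 with hy | hy
    · exact same 1 (Or.inl rfl) hx hy
    · exact ⟨false, PLE.before_of_sublist (by
        simpa [fullExt, PLE.ofPairwise] using
          pair_sublist_append (mem_layerList.2 hx) (mem_layerList.2 hy))⟩
  · exact same k (Or.inr rfl) hx (by omega)

/-- The trace of `s` on the `c`-th block of `b` consecutive points. -/
noncomputable def blockTrace (b c : ℕ) (s : Finset (Fin n)) : Finset (Fin b) :=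
  Finset.univ.filter fun r => ∃ i ∈ s, (i : ℕ) / b = c ∧ (i : ℕ) % b = r

/-- The `k`-sets whose trace on block `c` is `T`. -/
noncomputable def traceSets (n k b c : ℕ) (T : Finset (Fin b)) : Finset (BoolLayers n 1 k) :=
  Finset.univ.filter fun x => x.1.card = k ∧ blockTrace b c x.1 = T

/-- The singletons of block `c` that avoid `T`. -/
noncomputable def offTraceSingletons (n k b c : ℕ) (T : Finset (Fin b)) :
    Finset (BoolLayers n 1 k) :=
  Finset.univ.filter fun x => x.1.card = 1 ∧
    ∀ i ∈ x.1, (i : ℕ) / b = c ∧ ∀ r ∈ T, (i : ℕ) % b ≠ r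

/-- The partial linear extension listing the `k`-sets with trace `T` on block `c`, followed by
the singletons of that block that avoid `T`. -/
noncomputable def blockExt (n k b c : ℕ) (hb : 0 < b) (T : Finset (Fin b)) : PLE (BoolLayers n 1 k) :=
  PLE.ofPairwise ((traceSets n k b c T).toList ++ (offTraceSingletons n k b c T).toList) <| by
    refine List.pairwise_append.2 ⟨pairwise_of_card (c := k) (Finset.nodup_toList _) ?_,
      pairwise_of_card (c := 1) (Finset.nodup_toList _) ?_, ?_⟩
    · simp +contextual [traceSets]
    · simp +contextual [offTraceSingletons]
    · intro x hx y hy hyx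
      simp only [traceSets, offTraceSingletons, Finset.mem_toList, Finset.mem_filter,
        Finset.mem_univ, true_and] at hx hy
      obtain ⟨i, hi⟩ := Finset.card_pos.1 (by omega : 0 < y.1.card)
      obtain ⟨h1, h2⟩ := hy.2 i hi
      have hr : (⟨i % b, Nat.mod_lt _ hb⟩ : Fin b) ∈ T := by
        rw [← hx.2]
        simp only [blockTrace, Finset.mem_filter, Finset.mem_univ, true_and]
        exact ⟨i, hyx hi, h1, rfl⟩
      exact h2 _ hr rfl

lemma mem_blockExt {b c : ℕ} {hb : 0 < b} {T : Finset (Fin b)} {x : BoolLayers n 1 k} :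
    x ∈ (blockExt n k b c hb T).toList ↔
      x ∈ traceSets n k b c T ∨ x ∈ offTraceSingletons n k b c T := by
  simp [blockExt, PLE.ofPairwise]

/-- The two linear extensions `fullExt` together with the partial linear extensions `blockExt`
of all blocks. -/
noncomputable def blockFamily (n k b m : ℕ) (hk : 2 ≤ k) (hb : 0 < b) :
    Bool ⊕ (Fin m × Finset (Fin b)) → PLE (BoolLayers n 1 k)
  | .inl r => fullExt n k hk r
  | .inr p => blockExt n k b p.1 hb p.2

lemma blockFamily_isLocalRealiser {b m : ℕ} (hk : 2 ≤ k) (hb : 0 < b) (hm : n < b * m) :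
    IsLocalRealiser (blockFamily n k b m hk hb) := by
  intro x y hyx
  have hne : x ≠ y := fun h => hyx h.ge
  by_cases hxy : x.1.card = 1 ∨ y.1.card = k
  · obtain ⟨r, hr⟩ := exists_fullExt_before hk hne hxy
    exact ⟨.inl r, hr⟩
  · push Not at hxy
    have hx : x.1.card = k := x.2.resolve_left hxy.1
    have hy : y.1.card = 1 := y.2.resolve_right hxy.2
    obtain ⟨i, hi⟩ := Finset.card_eq_one.1 hy
    have hix : i ∉ x.1 := fun h => hyx (by
      change y.1 ⊆ x.1
      simpa [hi] using h)
    have hc : (i : ℕ) / b < m := Nat.div_lt_of_lt_mul (i.2.trans hm)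
    refine ⟨.inr (⟨i / b, hc⟩, blockTrace b (i / b) x.1), PLE.before_of_sublist ?_⟩
    refine pair_sublist_append (by simp [traceSets, hx]) ?_
    simp only [offTraceSingletons, Finset.mem_toList, Finset.mem_filter, Finset.mem_univ,
      true_and, hi, Finset.mem_singleton, Finset.card_singleton, forall_eq]
    refine fun r hr h => hix ?_
    simp only [blockTrace, Finset.mem_filter, Finset.mem_univ, true_and] at hr
    obtain ⟨i', hi', h1, h2⟩ := hr
    have : i' = i := Fin.ext (by
      rw [← Nat.div_add_mod (i' : ℕ) b, ← Nat.div_add_mod (i : ℕ) b, h1, h2, h])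
    exact this ▸ hi'

lemma card_blockFamily_le {b m : ℕ} (hk : 2 ≤ k) (hb : 0 < b) (x : BoolLayers n 1 k) :
    (Finset.univ.filter fun i => x ∈ (blockFamily n k b m hk hb i).toList).card ≤
      2 + max m (2 ^ b) := by
  rw [Finset.card_filter, Fintype.sum_sum_type, ← Finset.card_filter, ← Finset.card_filter]
  refine add_le_add ((Finset.card_le_univ _).trans (by simp)) ?_
  simp only [blockFamily, mem_blockExt, traceSets, offTraceSingletons, Finset.mem_filter,
    Finset.mem_univ, true_and]
  rcases x.2 with hx | hx
  · have h1k : (1 : ℕ) ≠ k := by omega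
    refine le_trans ?_ (le_max_right _ _)
    refine (Finset.card_le_card_of_injOn (t := Finset.univ) Prod.snd
      (fun _ _ => Finset.mem_univ _) ?_).trans_eq (by simp)
    rintro ⟨c, T⟩ h ⟨c', T'⟩ h' hT
    obtain ⟨i, hi⟩ := Finset.card_eq_one.1 hx
    simp [hi, h1k] at h h' hT
    exact Prod.ext (Fin.ext (h.1.symm.trans h'.1)) hT
  · have h1k : k ≠ (1 : ℕ) := by omega
    refine le_trans ?_ (le_max_left _ _)
    refine (Finset.card_le_card_of_injOn (t := Finset.univ) Prod.fst
      (fun _ _ => Finset.mem_univ _) ?_).trans_eq (by simp)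
    rintro ⟨c, T⟩ h ⟨c', T'⟩ h' hT
    simp only [hx, h1k, true_and, false_and, or_false, Finset.coe_filter, Finset.mem_univ,
      Set.mem_ofPred_eq] at h h' hT
    exact Prod.ext hT (by rw [← h, ← h', hT])

lemma exists_realiser {b : ℕ} (hk : 2 ≤ k) (hb : 0 < b) :
    ∃ (N : ℕ) (F : Fin N → PLE (BoolLayers n 1 k)), IsLocalRealiser F ∧
      ∀ x, mult F x ≤ 2 + max (n / b + 1) (2 ^ b) :=
  exists_fin_realiser (blockFamily n k b (n / b + 1) hk hb)
    (blockFamily_isLocalRealiser hk hb (Nat.lt_mul_div_succ n hb)) _ fun x => by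
      convert card_blockFamily_le hk hb x

lemma ldim_le {b : ℕ} (hk : 2 ≤ k) (hb : 0 < b) :
    ldim (BoolLayers n 1 k) ≤ 2 + max (n / b + 1) (2 ^ b) :=
  Nat.sInf_le (exists_realiser hk hb)

/-- The singleton `{i}` as an element of the first layer. -/
def single (k : ℕ) (i : Fin n) : BoolLayers n 1 k := ⟨{i}, Or.inl (by simp)⟩

lemma single_injective : Function.Injective (single k : Fin n → BoolLayers n 1 k) := by
  intro i j h
  simpa [single] using h

/-- All pairs consisting of a list and a singleton that occurs in it. -/
noncomputable def occurrences {N : ℕ} (F : Fin N → PLE (BoolLayers n 1 k)) :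
    Finset (Fin N × Fin n) :=
  Finset.univ.filter fun p => single k p.2 ∈ (F p.1).toList

/-- For each list containing `x` before some singleton, the first singleton after `x`. -/
noncomputable def successors {N : ℕ} (F : Fin N → PLE (BoolLayers n 1 k))
    (x : BoolLayers n 1 k) : Finset (Fin N × Fin n) :=
  Finset.univ.filter fun p => (F p.1).Before x (single k p.2) ∧
    ∀ i, (F p.1).Before x (single k i) → (F p.1).Before (single k p.2) (single k i)

lemma card_occurrences_le {N d : ℕ} {F : Fin N → PLE (BoolLayers n 1 k)}
    (hd : ∀ x, mult F x ≤ d) : (occurrences F).card ≤ n * d := by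
  have : (occurrences F).card = ∑ i : Fin n, mult F (single k i) := by
    simp only [occurrences, mult, Finset.card_filter]
    rw [Fintype.sum_prod_type_right]
    refine Finset.sum_congr rfl fun _ _ => Finset.sum_congr rfl fun _ _ => ?_
    congr
  rw [this]
  exact (Finset.sum_le_sum fun i _ => hd (single k i)).trans (by simp)

lemma successors_subset {N : ℕ} (F : Fin N → PLE (BoolLayers n 1 k)) (x : BoolLayers n 1 k) :
    successors F x ⊆ occurrences F := by
  intro p hp
  simp only [successors, occurrences, Finset.mem_filter, Finset.mem_univ, true_and] at *
  exact (PLE.before_iff.1 hp.1).2.1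

lemma card_successors_le {N : ℕ} (F : Fin N → PLE (BoolLayers n 1 k)) (x : BoolLayers n 1 k) :
    (successors F x).card ≤ mult F x := by
  refine Finset.card_le_card_of_injOn Prod.fst ?_ ?_
  · intro p hp
    simp only [successors, Finset.coe_filter, Finset.mem_univ, true_and, Set.mem_ofPred_eq] at *
    exact (PLE.before_iff.1 hp.1).1
  · rintro ⟨j, i⟩ h ⟨j', i'⟩ h' hj
    simp only [successors, Finset.coe_filter, Finset.mem_univ, true_and, Set.mem_ofPred_eq]
      at h h' hj
    subst hj
    rw [single_injective ((h.2 i' h'.1).antisymm (h'.2 i h.1))]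

lemma notMem_iff_successors {N : ℕ} {F : Fin N → PLE (BoolLayers n 1 k)}
    (hF : IsLocalRealiser F) (hk : 2 ≤ k) {x : BoolLayers n 1 k} (hx : x.1.card = k)
    (i : Fin n) :
    i ∉ x.1 ↔ ∃ p ∈ successors F x, (F p.1).Before (single k p.2) (single k i) := by
  have hle : single k i ≤ x ↔ i ∈ x.1 := by
    change ({i} : Finset (Fin n)) ⊆ x.1 ↔ _
    simp
  have hne : x ≠ single k i := fun h => by
    have : x.1.card = 1 := by simp [h, single]
    omega
  constructor
  · intro hi
    obtain ⟨j, hj⟩ := hF x (single k i) (hle.not.2 hi)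
    obtain ⟨i₀, h₀, key⟩ := PLE.exists_first_after (single k) ⟨i, hj⟩
    exact ⟨(j, i₀), by simpa [successors] using ⟨h₀, key⟩, key i hj⟩
  · rintro ⟨p, hp, h⟩
    simp only [successors, Finset.mem_filter, Finset.mem_univ, true_and] at hp
    exact hle.not.1 ((hp.1.trans h).not_le hne)

/-- The number of subsets of size at most `d` of a set of size at most `n * d`. -/
lemma card_small_subsets_le {β : Type*} (U : Finset β) {n d : ℕ} (hn : 0 < n)
    (hU : U.card ≤ n * d) :
    ((U.powerset.filter fun A => A.card ≤ d).card : ℝ) ≤ (4 * n) ^ d := by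
  have hn' : (0 : ℝ) < n := by exact_mod_cast hn
  have hn1 : (1 : ℝ) ≤ n := by exact_mod_cast hn
  have h4 : (1 + (n : ℝ)⁻¹) ^ (n * d) ≤ 4 ^ d := by
    rw [pow_mul]
    refine pow_le_pow_left₀ (by positivity) ?_ d
    calc (1 + (n : ℝ)⁻¹) ^ n ≤ (Real.exp (n : ℝ)⁻¹) ^ n :=
          pow_le_pow_left₀ (by positivity) (by linarith [Real.add_one_le_exp (n : ℝ)⁻¹]) n
      _ = Real.exp 1 := by rw [← Real.exp_nat_mul, mul_inv_cancel₀ hn'.ne']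
      _ ≤ 4 := by linarith [Real.exp_one_lt_d9]
  calc ((U.powerset.filter fun A => A.card ≤ d).card : ℝ)
      = ∑ A ∈ U.powerset.filter fun A => A.card ≤ d, (1 : ℝ) := by simp
    _ ≤ ∑ A ∈ U.powerset.filter fun A => A.card ≤ d, (n : ℝ) ^ d * (n : ℝ)⁻¹ ^ A.card := by
        refine Finset.sum_le_sum fun A hA => ?_
        have hA' : A.card ≤ d := (Finset.mem_filter.1 hA).2
        rw [inv_pow, ← div_eq_mul_inv, one_le_div (by positivity)]
        exact pow_le_pow_right₀ hn1 hA'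
    _ ≤ ∑ A ∈ U.powerset, (n : ℝ) ^ d * (n : ℝ)⁻¹ ^ A.card :=
        Finset.sum_le_sum_of_subset_of_nonneg (Finset.filter_subset _ _)
          fun _ _ _ => by positivity
    _ = (n : ℝ) ^ d * (1 + (n : ℝ)⁻¹) ^ U.card := by
        rw [← Finset.mul_sum, add_comm, ← Finset.sum_pow_mul_eq_add_pow]
        simp
    _ ≤ (n : ℝ) ^ d * 4 ^ d := by
        refine mul_le_mul_of_nonneg_left (le_trans ?_ h4) (by positivity)
        exact pow_le_pow_right₀ (by simp) hU
    _ = (4 * n) ^ d := by rw [mul_pow, mul_comm]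

lemma choose_le_of_realiser {N d : ℕ} {F : Fin N → PLE (BoolLayers n 1 k)}
    (hF : IsLocalRealiser F) (hd : ∀ x, mult F x ≤ d) (hn : 0 < n) (hk : 2 ≤ k) :
    (n.choose k : ℝ) ≤ (4 * n) ^ d := by
  refine le_trans ?_ (card_small_subsets_le (occurrences F) hn (card_occurrences_le hd))
  have hc : n.choose k = (Finset.univ.filter fun x : BoolLayers n 1 k => x.1.card = k).card := by
    have : n.choose k = ((Finset.univ : Finset (Fin n)).powersetCard k).card := by simp
    rw [this]
    refine (Finset.card_bij (fun x _ => x.1) ?_ ?_ ?_).symm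
    · intro x hx
      simpa [Finset.mem_powersetCard] using hx
    · intro x _ y _ h
      exact Subtype.ext h
    · intro s hs
      have hs' : s.card = k := by simpa [Finset.mem_powersetCard] using hs
      exact ⟨⟨s, Or.inr hs'⟩, by simpa using hs', rfl⟩
  rw [hc]
  norm_cast
  refine Finset.card_le_card_of_injOn (successors F) ?_ ?_
  · intro x _
    simp only [Finset.coe_filter, Finset.mem_powerset, Set.mem_ofPred_eq]
    exact ⟨successors_subset F x, (card_successors_le F x).trans (hd x)⟩
  · intro x hx y hy hxy
    simp only [Finset.coe_filter, Finset.mem_univ, true_and, Set.mem_ofPred_eq] at hx hy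
    refine Subtype.ext (Finset.ext fun i => not_iff_not.1 ?_)
    rw [notMem_iff_successors hF hk hx, notMem_iff_successors hF hk hy, hxy]

lemma two_pow_le_ldim (hn : 4 ≤ n) :
    (2 : ℝ) ^ n ≤ (n + 1) * (4 * n) ^ ldim (BoolLayers n 1 (n / 2)) := by
  have hk : 2 ≤ n / 2 := by omega
  obtain ⟨N, F, hF, hd⟩ : ldim (BoolLayers n 1 (n / 2)) ∈ {d | ∃ (N : ℕ)
      (F : Fin N → PLE (BoolLayers n 1 (n / 2))), IsLocalRealiser F ∧ ∀ x, mult F x ≤ d} :=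
    Nat.sInf_mem ⟨_, exists_realiser hk one_pos⟩
  have h := choose_le_of_realiser hF hd (by omega) hk
  have h2 : 2 ^ n ≤ (n + 1) * n.choose (n / 2) := by
    rw [← Nat.sum_range_choose]
    exact (Finset.sum_le_card_nsmul _ _ _ fun i _ => Nat.choose_le_middle i n).trans (by simp)
  calc (2 : ℝ) ^ n ≤ (n + 1) * n.choose (n / 2) := by exact_mod_cast h2
    _ ≤ _ := mul_le_mul_of_nonneg_left h (by positivity)

end TwoLayers

section Estimates

lemma logb_two_le {x : ℝ} (hx : 0 < x) : Real.logb 2 x ≤ 3 / 4 * x := by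
  have h2 := Real.log_two_gt_d9
  have h2' := Real.log_two_lt_d9
  have h := Real.log_le_sub_one_of_pos (show 0 < x / 2 by positivity)
  rw [Real.log_div hx.ne' two_ne_zero] at h
  rw [Real.logb, div_le_iff₀ (by linarith)]
  nlinarith

lemma sq_logb_two_le {x : ℝ} (hx : 1 ≤ x) : Real.logb 2 x ^ 2 ≤ 9 * x := by
  have hx0 : 0 < x := by linarith
  have h := logb_two_le (Real.sqrt_pos.2 hx0)
  have h0 := Real.logb_nonneg one_lt_two hx
  have hs : Real.logb 2 x = 2 * Real.logb 2 (Real.sqrt x) := by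
    conv_lhs => rw [← Real.sq_sqrt hx0.le]
    rw [Real.logb_pow]
    norm_num
  have h1 : Real.logb 2 x ≤ 3 * Real.sqrt x := by
    have := Real.sqrt_nonneg x
    linarith
  calc Real.logb 2 x ^ 2 ≤ (3 * Real.sqrt x) ^ 2 := pow_le_pow_left₀ h0 h1 2
    _ = 9 * x := by rw [mul_pow, Real.sq_sqrt hx0.le]; norm_num

lemma sub_ldim_le {n : ℕ} (hn : 4 ≤ n) :
    n / Real.logb 2 n - ldim (BoolLayers n 1 (n / 2)) ≤ 2 * n / Real.logb 2 n ^ 2 + 1 := by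
  have hn' : (4 : ℝ) ≤ n := by exact_mod_cast hn
  have hL : 0 < Real.logb 2 n := Real.logb_pos one_lt_two (by linarith)
  set L := Real.logb 2 n
  set d := ldim (BoolLayers n 1 (n / 2))
  have h2L : Real.logb 2 (2 * n) = 1 + L := by
    rw [Real.logb_mul two_ne_zero (by positivity), Real.logb_self_eq_one one_lt_two]
  have h4L : Real.logb 2 (4 * n) = 2 + L := by
    rw [Real.logb_mul (by norm_num) (by positivity), show (4 : ℝ) = 2 ^ 2 by norm_num,
      Real.logb_pow, Real.logb_self_eq_one one_lt_two, Nat.cast_ofNat, mul_one]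
  have h : (2 : ℝ) ^ n ≤ (2 * n) * (4 * n) ^ d :=
    (two_pow_le_ldim hn).trans (mul_le_mul_of_nonneg_right (by linarith) (by positivity))
  have h' := Real.logb_le_logb_of_le one_lt_two (by positivity) h
  rw [Real.logb_mul (by positivity) (by positivity), Real.logb_pow, Real.logb_pow, h2L, h4L,
    Real.logb_self_eq_one one_lt_two, mul_one] at h'
  have h1 : n / (L + 2) - 1 ≤ (d : ℝ) := by
    rw [sub_le_iff_le_add, div_le_iff₀ (by positivity)]
    nlinarith
  have h3 : n / L - n / (L + 2) ≤ 2 * n / L ^ 2 := by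
    rw [div_sub_div _ _ (by positivity) (by positivity),
      div_le_div_iff₀ (by positivity) (by positivity)]
    have : 0 ≤ n * L ^ 2 := by positivity
    nlinarith [mul_pos hL hL]
  linarith

lemma ldim_sub_le {n : ℕ} (hn : 4 ≤ n) :
    ldim (BoolLayers n 1 (n / 2)) - n / Real.logb 2 n ≤
      16 * n * Real.logb 2 (Real.logb 2 n) / Real.logb 2 n ^ 2 + 3 := by
  have hn' : (4 : ℝ) ≤ n := by exact_mod_cast hn
  have hL2 : 2 ≤ Real.logb 2 n := by
    rw [Real.le_logb_iff_rpow_le one_lt_two (by linarith)]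
    norm_num
    exact hn
  set L := Real.logb 2 n with hLdef
  have hl1 : 1 ≤ Real.logb 2 L := by
    rw [Real.le_logb_iff_rpow_le one_lt_two (by linarith)]
    simpa using hL2
  have hl := logb_two_le (show 0 < L by linarith)
  set l := Real.logb 2 L with hldef
  have hlL : 1 ≤ L - l := by
    have h := one_add_mul_self_le_rpow_one_add (show (-1 : ℝ) ≤ 1 by norm_num)
      (show 1 ≤ L - 1 by linarith)
    have h' : l ≤ L - 1 := by
      rw [hldef, Real.logb_le_iff_le_rpow one_lt_two (by linarith)]
      norm_num at h
      exact h
    linarith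
  set b := ⌊L - l⌋₊ with hb
  have hb1 : 1 ≤ b := Nat.le_floor (by simpa using hlL)
  have hble : (b : ℝ) ≤ L - l := Nat.floor_le (by linarith)
  have hblt : L - l < b + 1 := Nat.lt_floor_add_one _
  have hb1' : (1 : ℝ) ≤ b := by exact_mod_cast hb1
  have hbL : L ≤ 8 * b := by linarith
  have hdiv : (n : ℝ) / b - n / L ≤ 16 * n * l / L ^ 2 := by
    rw [div_sub_div _ _ (by positivity) (by positivity),
      div_le_div_iff₀ (by positivity) (by positivity)]
    have e1 : L - b ≤ 2 * l := by linarith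
    have e2 : (L - b) * L ≤ 2 * l * (8 * b) :=
      mul_le_mul e1 hbL (by linarith) (by linarith)
    have : 0 ≤ n * L := by positivity
    nlinarith [mul_le_mul_of_nonneg_left e2 this]
  have hpow : (2 : ℝ) ^ b ≤ n / L := by
    rw [← Real.rpow_natCast]
    calc (2 : ℝ) ^ (b : ℝ) ≤ 2 ^ (L - l) := Real.rpow_le_rpow_of_exponent_le one_le_two hble
      _ = n / L := by
        rw [Real.rpow_sub two_pos, hLdef, hldef,
          Real.rpow_logb two_pos (by norm_num) (by linarith),
          Real.rpow_logb two_pos (by norm_num) (by linarith)]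
  have hpos : 0 ≤ 16 * n * l / L ^ 2 := by positivity
  have hdim : (ldim (BoolLayers n 1 (n / 2)) : ℝ) ≤ 2 + max ((n / b : ℕ) + 1 : ℝ) (2 ^ b) := by
    exact_mod_cast ldim_le (n := n) (k := n / 2) (by omega) hb1
  have hnat : ((n / b : ℕ) : ℝ) ≤ n / b := Nat.cast_div_le
  rcases max_cases ((n / b : ℕ) + 1 : ℝ) (2 ^ b) with ⟨h, _⟩ | ⟨h, _⟩
  · rw [h] at hdim
    linarith
  · rw [h] at hdim
    linarith

end Estimates

end PaperLD

/-- There is a constant `C > 0` such that for every `n ≥ 4`,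
`|ldim(Q(n; 1, ⌊n/2⌋)) − n/log n| ≤ C·n·log log n/(log n)²` (logs base 2);
in particular `ldim(Q(n; 1, ⌊n/2⌋)) ∼ n/log n`. -/
theorem stmt0 :
    ∃ C : ℝ, 0 < C ∧ ∀ n : ℕ, 4 ≤ n →
      |(ldim (BoolLayers n 1 (n / 2)) : ℝ) - n / Real.logb 2 n| ≤
        C * n * Real.logb 2 (Real.logb 2 n) / (Real.logb 2 n) ^ 2 := by
  refine ⟨45, by norm_num, fun n hn => ?_⟩
  have hn' : (4 : ℝ) ≤ n := by exact_mod_cast hn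
  have hL2 : 2 ≤ Real.logb 2 n := by
    rw [Real.le_logb_iff_rpow_le one_lt_two (by linarith)]
    norm_num
    exact hn
  have hl1 : 1 ≤ Real.logb 2 (Real.logb 2 n) := by
    rw [Real.le_logb_iff_rpow_le one_lt_two (by linarith)]
    simpa using hL2
  have hlow := sub_ldim_le hn
  have hupp := ldim_sub_le hn
  have hsq := sq_logb_two_le (show (1 : ℝ) ≤ n by linarith)
  set L := Real.logb 2 n
  set l := Real.logb 2 L
  set q := n * l / L ^ 2 with hq
  have e1 : 16 * n * l / L ^ 2 = 16 * q := by rw [hq]; ring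
  have e2 : 45 * n * l / L ^ 2 = 45 * q := by rw [hq]; ring
  have hq1 : 1 ≤ 9 * q := by
    rw [hq, ← mul_div_assoc, one_le_div (by positivity)]
    nlinarith
  have e3 : 2 * n / L ^ 2 ≤ 2 * q := by
    rw [hq, ← mul_div_assoc]
    gcongr
    nlinarith
  rw [e2, abs_le]
  rw [e1] at hupp
  constructor
  · linarith
  · linarith
end

section
/- For every integer n ≥ 2, the average of ldim(P) over all partial orders P on the set {1, …, n} (each partial order taken with equal weight) is at least ⌊n²/4⌋ / (n · log(3n)). In particular, the maximum local dimension of an n-element poset is at least ⌊n²/4⌋ / (n · log(3n)) ≥ (1/4 − o(1)) · n / log n. -/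
open scoped Classical

open PaperLD

namespace PaperLD

/-- The partial order on `α` determined by a relation `r` that is a partial order. -/
def toPO {α : Type*} (r : α → α → Prop) (h : IsPartialOrder α r) : PartialOrder α where
  le := r
  le_refl := h.refl
  le_trans := h.trans
  le_antisymm := h.antisymm

/-- The local dimension of the poset `({1, …, n}, r)`. -/
noncomputable def ldimRel (n : ℕ) (r : Fin n → Fin n → Prop)
    (h : IsPartialOrder (Fin n) r) : ℕ :=
  @ldim (Fin n) (toPO r h) _

end PaperLD

namespace PaperLD

section Realisers

variable {α : Type*} [PartialOrder α]

/-- A pair `x ≱ y` as a two-element partial linear extension. -/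
def PLE.pair (x y : α) (h : ¬ y ≤ x) : PLE α where
  toList := [x, y]
  nodup := by
    have : x ≠ y := fun e => h e.ge
    simpa using this
  le_imp := by
    intro i j hij
    fin_cases i <;> fin_cases j <;> simp_all

theorem exists_isLocalRealiser [Fintype α] :
    ∃ (N : ℕ) (F : Fin N → PLE α), IsLocalRealiser F := by
  let S := {p : α × α // ¬ p.2 ≤ p.1}
  let e : S ≃ Fin (Fintype.card S) := Fintype.equivFin S
  refine ⟨Fintype.card S, fun i => PLE.pair (e.symm i).1.1 (e.symm i).1.2 (e.symm i).2, ?_⟩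
  intro x y h
  refine ⟨e ⟨(x, y), h⟩, ⟨0, by simp [PLE.pair]⟩, ⟨1, by simp [PLE.pair]⟩, ?_, ?_, ?_⟩
  · simp
  · simp [PLE.pair]
  · simp [PLE.pair]

theorem exists_localRealiser_ldim [Fintype α] :
    ∃ (N : ℕ) (F : Fin N → PLE α), IsLocalRealiser F ∧ ∀ x : α, mult F x ≤ ldim α := by
  refine Nat.sInf_mem (s := {d | ∃ (N : ℕ) (F : Fin N → PLE α),
    IsLocalRealiser F ∧ ∀ x : α, mult F x ≤ d}) ?_
  obtain ⟨N, F, hF⟩ := exists_isLocalRealiser (α := α)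
  refine ⟨N, N, F, hF, fun x => ?_⟩
  exact (Finset.card_le_univ _).trans (by simp)

theorem ldim_pos [Fintype α] [Nontrivial α] : 1 ≤ ldim α := by
  obtain ⟨N, F, hF, hd⟩ := exists_localRealiser_ldim (α := α)
  obtain ⟨a, b, hab⟩ := exists_pair_ne α
  obtain ⟨x, y, hxy⟩ : ∃ x y : α, ¬ y ≤ x := by
    by_contra! h
    exact hab (le_antisymm (h b a) (h a b))
  obtain ⟨i, j, k, -, hj, -⟩ := hF x y hxy
  refine le_trans ?_ (hd x)
  refine Finset.card_pos.2 ⟨i, ?_⟩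
  simp only [Finset.mem_filter, Finset.mem_univ, true_and]
  exact hj ▸ List.get_mem _ _

theorem PLE.not_before_of_lt (L : PLE α) {x y : α} (h : x < y) : ¬ L.Before y x := by
  rintro ⟨i, j, hij, rfl, rfl⟩
  have := le_antisymm hij (L.le_imp j i h.le)
  simp [this] at h

theorem IsLocalRealiser.le_iff {ι : Type*} {F : ι → PLE α} (hF : IsLocalRealiser F) (x y : α) :
    x ≤ y ↔ x = y ∨ ¬ ∃ i, (F i).Before y x := by
  constructor
  · intro h
    rcases h.eq_or_lt with h | h
    · exact Or.inl h
    · exact Or.inr fun ⟨i, hi⟩ => (F i).not_before_of_lt h hi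
  · rintro (h | h)
    · exact h.le
    · by_contra hxy
      exact h (hF y x hxy)

theorem sum_length_eq_sum_mult [Fintype α] {N : ℕ} (F : Fin N → PLE α) :
    ∑ i, (F i).toList.length = ∑ x, mult F x := by
  have h : ∀ i, (F i).toList.length = ∑ x, if x ∈ (F i).toList then 1 else 0 := by
    intro i
    rw [← List.toFinset_card_of_nodup (F i).nodup, ← Finset.card_filter]
    congr 1
    ext x
    simp
  simp only [h, mult, Finset.card_filter]
  exact Finset.sum_comm

end Realisers

section Words

variable {α : Type*}

/-- Cut a word into blocks: a letter marked `true` lies in the same block as its successor. -/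
def blocks : List (α × Bool) → List (List α)
  | [] => []
  | (a, false) :: w => [a] :: blocks w
  | (a, true) :: w =>
    match blocks w with
    | [] => [[a]]
    | l :: ls => (a :: l) :: ls

theorem exists_blocks_eq (ls : List (List α)) (h : [] ∉ ls) :
    ∃ w, blocks w = ls ∧ w.length = ls.flatten.length := by
  induction ls with
  | nil => exact ⟨[], rfl, rfl⟩
  | cons l ls ih =>
    simp only [List.mem_cons, not_or] at h
    obtain ⟨w, hw, hlen⟩ := ih h.2
    have h1 := h.1
    clear h ih
    induction l with
    | nil => exact absurd rfl h1
    | cons a l ih =>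
      rcases eq_or_ne l [] with rfl | hl
      · exact ⟨(a, false) :: w, by simp [blocks, hw], by simp [hlen]⟩
      · obtain ⟨v, hv, hv'⟩ := ih hl.symm
        exact ⟨(a, true) :: v, by simp [blocks, hv], by simp at hv'; simp [hv']⟩

/-- `x` occurs weakly before `y` in the list `l`. -/
def ListBefore (l : List α) (x y : α) : Prop :=
  ∃ i j : Fin l.length, i ≤ j ∧ l.get i = x ∧ l.get j = y

/-- The relation encoded by a list of lists. -/
def listsRel (ls : List (List α)) (x y : α) : Prop :=
  x = y ∨ ¬ ∃ l ∈ ls, ListBefore l y x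

theorem listsRel_append_replicate (ls : List (List α)) (k : ℕ) (a : α) :
    listsRel (ls ++ List.replicate k [a]) = listsRel ls := by
  have h : ∀ x y, ListBefore [a] y x → x = y := by
    rintro x y ⟨i, j, -, rfl, rfl⟩
    simp
  ext x y
  unfold listsRel
  by_cases hxy : x = y
  · simp [hxy]
  · simp only [hxy, false_or, not_iff_not, List.mem_append, List.mem_replicate]
    constructor
    · rintro ⟨l, hl | ⟨-, rfl⟩, hb⟩
      · exact ⟨l, hl, hb⟩
      · exact absurd (h x y hb) hxy
    · rintro ⟨l, hl, hb⟩
      exact ⟨l, Or.inl hl, hb⟩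

theorem exists_word_of_poset [Fintype α] [Nonempty α] [PartialOrder α] :
    ∃ w : List.Vector (α × Bool) (Fintype.card α * ldim α),
      ∀ x y : α, x ≤ y ↔ listsRel (blocks w.toList) x y := by
  obtain ⟨N, F, hF, hd⟩ := exists_localRealiser_ldim (α := α)
  let a : α := Classical.arbitrary α
  let ls := (List.ofFn fun i => (F i).toList).filter (fun l => !l.isEmpty)
  have hlen : ls.flatten.length ≤ Fintype.card α * ldim α := by
    calc ls.flatten.length ≤ (List.ofFn fun i => (F i).toList).flatten.length :=
          (List.Sublist.flatten List.filter_sublist).length_le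
      _ = ∑ i, (F i).toList.length := by
          rw [List.length_flatten, List.map_ofFn, List.sum_ofFn]; rfl
      _ = ∑ x, mult F x := sum_length_eq_sum_mult F
      _ ≤ ∑ _x : α, ldim α := Finset.sum_le_sum fun x _ => hd x
      _ = _ := by simp
  obtain ⟨w, hw, hwl⟩ := exists_blocks_eq
    (ls ++ List.replicate (Fintype.card α * ldim α - ls.flatten.length) [a]) (by simp [ls])
  have hwl' : w.length = Fintype.card α * ldim α := by
    rw [hwl]
    simp only [List.flatten_append, List.length_append, List.length_flatten (L := List.replicate _ _),
      List.map_replicate, List.sum_replicate, List.length_singleton, smul_eq_mul, mul_one]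
    omega
  refine ⟨⟨w, hwl'⟩, fun x y => ?_⟩
  rw [List.Vector.toList_mk, hw, listsRel_append_replicate, hF.le_iff]
  refine or_congr_right (not_congr ?_)
  constructor
  · rintro ⟨i, hi⟩
    refine ⟨(F i).toList, ?_, hi⟩
    obtain ⟨j, -⟩ := hi
    have : (F i).toList ≠ [] := List.ne_nil_of_length_pos j.pos
    simp [ls, this]
  · rintro ⟨l, hl, hb⟩
    simp only [ls, List.mem_filter, List.mem_ofFn] at hl
    obtain ⟨⟨i, rfl⟩, -⟩ := hl
    exact ⟨i, hb⟩

end Words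

/-- Partial orders on `Fin n`, as relations. -/
abbrev POrd (n : ℕ) := {r : Fin n → Fin n → Prop // IsPartialOrder (Fin n) r}

theorem exists_word_of_rel {n : ℕ} (hn : 0 < n) (r : POrd n) :
    ∃ w : List.Vector (Fin n × Bool) (n * ldimRel n r.1 r.2),
      r.1 = listsRel (blocks w.toList) := by
  have : Nonempty (Fin n) := ⟨⟨0, hn⟩⟩
  obtain ⟨w, hw⟩ := @exists_word_of_poset (Fin n) _ _ (toPO r.1 r.2)
  refine ⟨⟨w.1, w.2.trans (by simp [ldimRel])⟩, ?_⟩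
  ext x y
  exact hw x y

theorem card_ldimRel_eq_le {n : ℕ} (hn : 0 < n) (d : ℕ) :
    (Finset.univ.filter fun r : POrd n => ldimRel n r.1 r.2 = d).card ≤ (2 * n) ^ (n * d) := by
  have hc : Fintype.card (List.Vector (Fin n × Bool) (n * d)) = (2 * n) ^ (n * d) := by
    rw [card_vector]; simp [mul_comm]
  rw [← hc, ← Finset.card_univ]
  have hex : ∀ r ∈ Finset.univ.filter fun r : POrd n => ldimRel n r.1 r.2 = d,
      ∃ w : List.Vector (Fin n × Bool) (n * d), r.1 = listsRel (blocks w.toList) := by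
    intro r hr
    obtain rfl := (Finset.mem_filter.1 hr).2
    exact exists_word_of_rel hn r
  have : Nonempty (List.Vector (Fin n × Bool) (n * d)) := ⟨.replicate _ (⟨0, hn⟩, false)⟩
  choose! f hf using hex
  refine Finset.card_le_card_of_injOn f (fun _ _ => Finset.mem_univ _) ?_
  intro r hr s hs hrs
  apply Subtype.ext
  rw [hf r hr, hf s hs, hrs]

theorem ldimRel_pos {n : ℕ} (hn : 2 ≤ n) (r : POrd n) : 1 ≤ ldimRel n r.1 r.2 := by
  have : Nontrivial (Fin n) := Fin.nontrivial_iff_two_le.2 hn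
  exact @ldim_pos (Fin n) (toPO r.1 r.2) _ _

theorem sum_Ico_one_half_pow_le (D : ℕ) : ∑ d ∈ Finset.Ico 1 (D + 1), (1 / 2 : ℝ) ^ d ≤ 1 := by
  have : ∑ d ∈ Finset.Ico 1 (D + 1), (1 / 2 : ℝ) ^ d = 1 - (1 / 2) ^ D := by
    induction D with
    | zero => simp
    | succ D ih => rw [Finset.sum_Ico_succ_top (by omega), ih]; ring
  rw [this]
  linarith [pow_pos (one_half_pos (α := ℝ)) D]

theorem kraft_ldimRel {n : ℕ} (hn : 2 ≤ n) :
    ∑ r : POrd n, (((3 * n : ℝ) ^ (n * ldimRel n r.1 r.2))⁻¹) ≤ 1 := by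
  have hn0 : (0 : ℝ) < n := by exact_mod_cast (by omega : 0 < n)
  let D := Finset.univ.sup fun r : POrd n => ldimRel n r.1 r.2
  have hmaps : ∀ r ∈ (Finset.univ : Finset (POrd n)),
      ldimRel n r.1 r.2 ∈ Finset.Ico 1 (D + 1) := by
    intro r hr
    rw [Finset.mem_Ico]
    exact ⟨ldimRel_pos hn r,
      Nat.lt_succ_of_le (Finset.le_sup (f := fun r : POrd n => ldimRel n r.1 r.2) hr)⟩
  rw [← Finset.sum_fiberwise_of_maps_to hmaps]
  refine le_trans (Finset.sum_le_sum fun d _ => ?_) (sum_Ico_one_half_pow_le D)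
  calc ∑ r : POrd n with ldimRel n r.1 r.2 = d, (((3 * n : ℝ) ^ (n * ldimRel n r.1 r.2))⁻¹)
      = ∑ r : POrd n with ldimRel n r.1 r.2 = d, (((3 * n : ℝ) ^ (n * d))⁻¹) :=
        Finset.sum_congr rfl fun r hr => by rw [(Finset.mem_filter.1 hr).2]
    _ = (Finset.univ.filter fun r : POrd n => ldimRel n r.1 r.2 = d).card *
          ((3 * n : ℝ) ^ (n * d))⁻¹ := by rw [Finset.sum_const, nsmul_eq_mul]
    _ ≤ (2 * n : ℝ) ^ (n * d) * ((3 * n : ℝ) ^ (n * d))⁻¹ := by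
        gcongr
        exact_mod_cast card_ldimRel_eq_le (by omega) d
    _ = ((2 / 3 : ℝ) ^ n) ^ d := by
        rw [← div_eq_mul_inv, ← div_pow, mul_div_mul_right _ _ hn0.ne', pow_mul]
    _ ≤ (1 / 2 : ℝ) ^ d := by
        gcongr
        calc (2 / 3 : ℝ) ^ n ≤ (2 / 3) ^ 2 := pow_le_pow_of_le_one (by norm_num) (by norm_num) hn
          _ ≤ 1 / 2 := by norm_num

/-- The height-two partial order given by a set of pairs from lower half to upper half. -/
def bipartiteRel {n : ℕ} (S : Set ({i : Fin n // i.1 < n / 2} × {i : Fin n // ¬ i.1 < n / 2}))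
    (x y : Fin n) : Prop :=
  x = y ∨ ∃ p ∈ S, p.1.1 = x ∧ p.2.1 = y

theorem isPartialOrder_bipartiteRel {n : ℕ}
    (S : Set ({i : Fin n // i.1 < n / 2} × {i : Fin n // ¬ i.1 < n / 2})) :
    IsPartialOrder (Fin n) (bipartiteRel S) where
  refl x := Or.inl rfl
  trans := by
    rintro x y z (rfl | ⟨p, hp, rfl, rfl⟩) (rfl | ⟨q, hq, h, rfl⟩)
    · exact Or.inl rfl
    · exact Or.inr ⟨q, hq, h, rfl⟩
    · exact Or.inr ⟨p, hp, rfl, rfl⟩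
    · exact absurd (h ▸ q.1.2) p.2.2
  antisymm := by
    rintro x y (rfl | ⟨p, hp, rfl, rfl⟩) (h | ⟨q, hq, h, h'⟩)
    · rfl
    · rfl
    · exact h.symm
    · exact absurd (h ▸ q.1.2) p.2.2

theorem two_pow_le_card_pOrd (n : ℕ) : 2 ^ (n ^ 2 / 4) ≤ Fintype.card (POrd n) := by
  have hA : Fintype.card {i : Fin n // i.1 < n / 2} = n / 2 := by
    rw [Fintype.card_subtype, Fin.card_filter_val_lt]
    omega
  have hB : Fintype.card {i : Fin n // ¬ i.1 < n / 2} = n - n / 2 := by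
    rw [Fintype.card_subtype_compl, hA, Fintype.card_fin]
  have hmul : n ^ 2 / 4 = n / 2 * (n - n / 2) := by
    rcases Nat.even_or_odd' n with ⟨k, rfl | rfl⟩
    · rw [show 2 * k / 2 = k by omega, show 2 * k - k = k by omega,
        show (2 * k) ^ 2 = 4 * (k * k) by ring]
      omega
    · rw [show (2 * k + 1) / 2 = k by omega, show 2 * k + 1 - k = k + 1 by omega,
        show (2 * k + 1) ^ 2 = 4 * (k * (k + 1)) + 1 by ring]
      omega
  have hc : Fintype.card (Set ({i : Fin n // i.1 < n / 2} × {i : Fin n // ¬ i.1 < n / 2})) =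
      2 ^ (n ^ 2 / 4) := by
    rw [Fintype.card_set, Fintype.card_prod, hA, hB, hmul]
  rw [← hc]
  refine Fintype.card_le_of_injective
    (fun S => (⟨bipartiteRel S, isPartialOrder_bipartiteRel S⟩ : POrd n)) ?_
  have key : ∀ (S : Set ({i : Fin n // i.1 < n / 2} × {i : Fin n // ¬ i.1 < n / 2})) p,
      bipartiteRel S p.1.1 p.2.1 ↔ p ∈ S := by
    intro S p
    constructor
    · rintro (h | ⟨q, hq, h1, h2⟩)
      · exact absurd (h ▸ p.1.2) p.2.2
      · rwa [← Prod.ext (Subtype.ext h1) (Subtype.ext h2)]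
    · exact fun hp => Or.inr ⟨p, hp, rfl, rfl⟩
  intro S T hST
  have hST' : bipartiteRel S = bipartiteRel T := congrArg Subtype.val hST
  ext p
  rw [← key S p, ← key T p, hST']

/-- Kraft's inequality implies the noiseless coding bound for the uniform distribution. -/
theorem card_mul_log_card_le_sum {ι : Type*} [Fintype ι] [Nonempty ι] (ℓ : ι → ℝ)
    (h : ∑ i, Real.exp (-ℓ i) ≤ 1) :
    Fintype.card ι * Real.log (Fintype.card ι) ≤ ∑ i, ℓ i := by
  have hM : (0 : ℝ) < Fintype.card ι := by exact_mod_cast Fintype.card_pos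
  have h1 : ∑ i, (-ℓ i + Real.log (Fintype.card ι) + 1) ≤
      ∑ i, Real.exp (-ℓ i) * Fintype.card ι := by
    refine Finset.sum_le_sum fun i _ => ?_
    calc _ ≤ Real.exp (-ℓ i + Real.log (Fintype.card ι)) := Real.add_one_le_exp _
      _ = _ := by rw [Real.exp_add, Real.exp_log hM]
  rw [← Finset.sum_mul] at h1
  simp only [Finset.sum_add_distrib, Finset.sum_neg_distrib, Finset.sum_const, Finset.card_univ,
    nsmul_eq_mul, mul_one] at h1
  nlinarith [mul_le_mul_of_nonneg_right h hM.le]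

theorem le_average_ldimRel {n : ℕ} (hn : 2 ≤ n) :
    ((n ^ 2 / 4 : ℕ) : ℝ) / (n * Real.logb 2 (3 * n)) ≤
      (∑ r : POrd n, (ldimRel n r.1 r.2 : ℝ)) / Fintype.card (POrd n) := by
  have hn0 : (2 : ℝ) ≤ n := by exact_mod_cast hn
  have hlog3 : 0 < Real.log (3 * n) := Real.log_pos (by linarith)
  have hlog2 : 0 < Real.log 2 := Real.log_pos (by norm_num)
  have hcard := two_pow_le_card_pOrd n
  have hpos : 0 < Fintype.card (POrd n) := lt_of_lt_of_le (by positivity) hcard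
  have : Nonempty (POrd n) := Fintype.card_pos_iff.1 hpos
  have hM : (0 : ℝ) < Fintype.card (POrd n) := by exact_mod_cast hpos
  have hkraft := card_mul_log_card_le_sum
    (fun r : POrd n => ((n * ldimRel n r.1 r.2 : ℕ) : ℝ) * Real.log (3 * n)) (by
      refine le_trans (le_of_eq (Finset.sum_congr rfl fun r _ => ?_)) (kraft_ldimRel hn)
      rw [Real.exp_neg, Real.exp_nat_mul, Real.exp_log (by linarith)])
  have hlogcard : ((n ^ 2 / 4 : ℕ) : ℝ) * Real.log 2 ≤ Real.log (Fintype.card (POrd n)) := by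
    rw [← Real.log_pow]
    exact Real.log_le_log (by positivity) (by exact_mod_cast hcard)
  have hsum : ∑ r : POrd n, ((n * ldimRel n r.1 r.2 : ℕ) : ℝ) * Real.log (3 * n) =
      (∑ r : POrd n, (ldimRel n r.1 r.2 : ℝ)) * (n * Real.log (3 * n)) := by
    rw [Finset.sum_mul]
    exact Finset.sum_congr rfl fun r _ => by push_cast; ring
  rw [hsum] at hkraft
  rw [Real.logb, ← mul_div_assoc, div_div_eq_mul_div, div_le_div_iff₀ (by positivity) hM]
  refine le_trans ?_ hkraft
  rw [mul_comm]
  gcongr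

end PaperLD

/-- For every `n ≥ 2`, the average of `ldim` over all partial orders on an `n`-set is at
least `⌊n²/4⌋ / (n log(3n))` (log base 2); in particular some `n`-element poset has local
dimension at least this bound. -/
theorem stmt4 (n : ℕ) (hn : 2 ≤ n) :
    ((n ^ 2 / 4 : ℕ) : ℝ) / (n * Real.logb 2 (3 * n)) ≤
      (∑ r : {r : Fin n → Fin n → Prop // IsPartialOrder (Fin n) r},
          (ldimRel n r.1 r.2 : ℝ)) /
        (Fintype.card {r : Fin n → Fin n → Prop // IsPartialOrder (Fin n) r}) ∧
    ∃ r : {r : Fin n → Fin n → Prop // IsPartialOrder (Fin n) r},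
      ((n ^ 2 / 4 : ℕ) : ℝ) / (n * Real.logb 2 (3 * n)) ≤ (ldimRel n r.1 r.2 : ℝ) := by
  have h := le_average_ldimRel hn
  refine ⟨h, ?_⟩
  by_contra! hlt
  have hpos : 0 < Fintype.card (POrd n) := lt_of_lt_of_le (by positivity) (two_pow_le_card_pOrd n)
  have : Nonempty (POrd n) := Fintype.card_pos_iff.1 hpos
  have hM : (0 : ℝ) < Fintype.card (POrd n) := by exact_mod_cast hpos
  have hs := Finset.sum_lt_sum_of_nonempty (s := (Finset.univ : Finset (POrd n)))
    Finset.univ_nonempty fun r _ => hlt r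
  rw [Finset.sum_const, Finset.card_univ, nsmul_eq_mul] at hs
  rw [le_div_iff₀ hM] at h
  linarith
end
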